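/- For every β ∈ Φ with β^ω ≠ 0: (β^ω)^∨ = (2/(2 − #N(β))) · Σ_{γ ∈ O(β)} γ^∨. -/

import Mathlib

open scoped RealInnerProductSpace

namespace Folding

variable {E : Type*} [NormedAddCommGroup E] [InnerProductSpace ℝ E]

/-- The coroot `α^∨ = 2α/(α,α)` of a nonzero vector `α`. -/
noncomputable def coroot (α : E) : E := (2 / ⟪α, α⟫) • α

/-- The reflection `s_α(x) = x - (α^∨, x) α`. -/
noncomputable def reflVec (α x : E) : E := x - ⟪coroot α, x⟫ • α

/-- `Φ` is a (finite, not necessarily reduced) root system in `E`. -/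
def IsRootSystem (Φ : Set E) : Prop :=
  Φ.Finite ∧ (0 : E) ∉ Φ ∧ Submodule.span ℝ Φ = ⊤ ∧
    (∀ α ∈ Φ, ∀ β ∈ Φ, reflVec α β ∈ Φ) ∧
    ∀ α ∈ Φ, ∀ β ∈ Φ, ∃ n : ℤ, ⟪coroot α, β⟫ = (n : ℝ)

/-- `Φ` is reduced: no root is half of another root. -/
def IsReducedRS (Φ : Set E) : Prop := ∀ α ∈ Φ, (2⁻¹ : ℝ) • α ∉ Φ

/-- `Φ` is irreducible: nonempty and not a disjoint union of two nonempty
mutually orthogonal subsets. -/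
def IsIrreducibleRS (Φ : Set E) : Prop :=
  Φ.Nonempty ∧
    ¬∃ Φ₁ Φ₂ : Set E, Φ₁.Nonempty ∧ Φ₂.Nonempty ∧ Φ₁ ∪ Φ₂ = Φ ∧ Disjoint Φ₁ Φ₂ ∧
      ∀ u ∈ Φ₁, ∀ v ∈ Φ₂, ⟪u, v⟫ = 0

/-- `Δ` is a basis (a set of simple roots) of the root system `Φ`:
it is a vector space basis of `E`, and every root is a linear combination of `Δ`
whose coefficients are all nonnegative integers or all nonpositive integers. -/
def IsBaseRS (Φ : Set E) (Δ : Finset E) : Prop :=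
  ↑Δ ⊆ Φ ∧ LinearIndependent ℝ (fun α : {x : E // x ∈ Δ} => (α : E)) ∧
    Submodule.span ℝ (Δ : Set E) = ⊤ ∧
    ∀ β ∈ Φ, ∃ c : E → ℤ, ((∀ α, 0 ≤ c α) ∨ (∀ α, c α ≤ 0)) ∧
      β = ∑ α ∈ Δ, (c α : ℝ) • α

/-- `ω` belongs to the Weyl group of `Φ`: it is a product of reflections in roots. -/
def InWeylGroup (Φ : Set E) (ω : E ≃ₗᵢ[ℝ] E) : Prop :=
  ∃ l : List E, (∀ α ∈ l, α ∈ Φ) ∧ ∀ x : E, ω x = l.foldr reflVec x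

/-- The average `x^ω = (1/o(ω)) Σ_{t=1}^{o(ω)} ω^t(x)`, where `o(ω)` is the order of `ω`. -/
noncomputable def avg (ω : E ≃ₗᵢ[ℝ] E) (x : E) : E :=
  (orderOf ω : ℝ)⁻¹ • ∑ t ∈ Finset.range (orderOf ω), (ω ^ (t + 1)) x

/-- The fixed-point set `E^ω`. -/
def fixedSet (ω : E ≃ₗᵢ[ℝ] E) : Set E := {x | ω x = x}

/-- The fixed-point subspace `E^ω`. -/
def fixedSubmodule (ω : E ≃ₗᵢ[ℝ] E) : Submodule ℝ E :=
  LinearMap.ker ((ω.toLinearEquiv : E →ₗ[ℝ] E) - LinearMap.id)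

/-- The folded root system `Φ_re^ω = {β^ω : β ∈ Φ, β^ω ≠ 0}`. -/
noncomputable def foldedRoots (Φ : Set E) (ω : E ≃ₗᵢ[ℝ] E) : Set E :=
  {v | v ≠ 0 ∧ ∃ β ∈ Φ, avg ω β = v}

/-- The `⟨ω⟩`-orbit `O(β) = {ω^t(β) : t ∈ ℤ}`. -/
def orbitOf (ω : E ≃ₗᵢ[ℝ] E) (β : E) : Set E := {γ | ∃ t : ℤ, (ω ^ t) β = γ}

/-- `N(β) = {γ ∈ O(β) : γ ≠ ±β, (β,γ) ≠ 0}`. -/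
def nbrOf (ω : E ≃ₗᵢ[ℝ] E) (β : E) : Set E :=
  {γ | γ ∈ orbitOf ω β ∧ γ ≠ β ∧ γ ≠ -β ∧ ⟪β, γ⟫ ≠ 0}


/-- `Δ^ω`: the averages of the simple roots whose `⟨ω⟩`-orbit avoids `α₀ = -htilde`. -/
noncomputable def simpleAvg (Δ : Finset E) (htilde : E) (ω : E ≃ₗᵢ[ℝ] E) : Set E :=
  {v | ∃ α ∈ (Δ : Set E), -htilde ∉ orbitOf ω α ∧ avg ω α = v}

/-- `π̄_S = (Σ_{α ∈ S} ϖ_α^∨)^ω` for a subset `S` of `Δ₀`. -/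
noncomputable def pibar (ω : E ≃ₗᵢ[ℝ] E) (ϖ : E → E) (S : Set E) : E :=
  avg ω (∑ᶠ γ ∈ S, ϖ γ)

end Folding


open Folding

namespace Folding

variable {E : Type*} [NormedAddCommGroup E] [InnerProductSpace ℝ E]

lemma reflVec_self {α : E} (hα : α ≠ 0) : reflVec α α = -α := by
  have h : ⟪α, α⟫ ≠ 0 := inner_self_ne_zero.2 hα
  rw [reflVec, coroot, real_inner_smul_left, div_mul_cancel₀ _ h, two_smul]
  abel

lemma IsRootSystem.ne_zero {Φ : Set E} (hΦ : IsRootSystem Φ) {α : E} (hα : α ∈ Φ) : α ≠ 0 :=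
  fun h => hΦ.2.1 (h ▸ hα)

lemma IsRootSystem.neg_mem {Φ : Set E} (hΦ : IsRootSystem Φ) {α : E} (hα : α ∈ Φ) : -α ∈ Φ :=
  reflVec_self (hΦ.ne_zero hα) ▸ hΦ.2.2.2.1 α hα α hα

lemma InWeylGroup.map_mem {Φ : Set E} (hΦ : IsRootSystem Φ) {ω : E ≃ₗᵢ[ℝ] E}
    (hω : InWeylGroup Φ ω) {β : E} (hβ : β ∈ Φ) : ω β ∈ Φ := by
  obtain ⟨l, hl, hfold⟩ := hω
  rw [hfold]
  clear hfold
  induction l with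
  | nil => simpa using hβ
  | cons α l ih =>
    rw [List.foldr_cons]
    exact hΦ.2.2.2.1 _ (hl _ (by simp)) _ (ih fun a ha => hl a (by simp [ha]))

lemma pow_apply_mem {Φ : Set E} {ω : E ≃ₗᵢ[ℝ] E} (hω : ∀ β ∈ Φ, ω β ∈ Φ)
    {β : E} (hβ : β ∈ Φ) (n : ℕ) : (ω ^ n) β ∈ Φ := by
  induction n with
  | zero => simpa using hβ
  | succ n ih => rw [pow_succ']; exact hω _ ih

/-- Distinct roots of equal length whose difference is not a root, and which are not opposite,
are orthogonal or form an angle of `2π/3`. -/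
lemma IsRootSystem.inner_eq_of_sub_notMem {Φ : Set E} (hΦ : IsRootSystem Φ) {β γ : E}
    (hβ : β ∈ Φ) (hγ : γ ∈ Φ) (hlen : ⟪γ, γ⟫ = ⟪β, β⟫) (hne : γ ≠ β) (hne' : γ ≠ -β)
    (h0 : ⟪β, γ⟫ ≠ 0) (hsub : γ - β ∉ Φ) : ⟪β, γ⟫ = -(⟪β, β⟫ / 2) := by
  obtain ⟨a, ha⟩ := hΦ.2.2.2.2 β hβ γ hγ
  have hL : 0 < ⟪β, β⟫ := real_inner_self_pos.2 (hΦ.ne_zero hβ)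
  have hinner : ⟪β, γ⟫ = a * ⟪β, β⟫ / 2 := by
    rw [coroot, real_inner_smul_left] at ha
    rw [← ha]
    field_simp
  have hminus : 0 < ⟪γ - β, γ - β⟫ := real_inner_self_pos.2 (sub_ne_zero.2 hne)
  have hplus : 0 < ⟪γ + β, γ + β⟫ :=
    real_inner_self_pos.2 fun h => hne' (eq_neg_of_add_eq_zero_left h)
  rw [real_inner_sub_sub_self] at hminus
  rw [real_inner_add_add_self] at hplus
  have hcomm : ⟪γ, β⟫ = ⟪β, γ⟫ := real_inner_comm _ _
  rw [hlen, hcomm, hinner] at hplus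
  rw [hlen, hcomm, hinner] at hminus
  have h1 : (a : ℝ) < 2 := by nlinarith
  have h2 : (-2 : ℝ) < a := by nlinarith
  have h1' : a < 2 := by exact_mod_cast h1
  have h2' : -2 < a := by exact_mod_cast h2
  have h3 : a ≠ 0 := by rintro rfl; exact h0 (by simp [hinner])
  have h4 : a ≠ 1 := by
    rintro rfl
    have := hΦ.2.2.2.1 β hβ γ hγ
    rw [reflVec, ha] at this
    exact hsub (by simpa using this)
  obtain rfl : a = -1 := by omega
  rw [hinner]; push_cast; ring

lemma IsBaseRS.exists_height {Φ : Set E} {Δ : Finset E} (hΔ : IsBaseRS Φ Δ) :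
    ∃ f : E →ₗ[ℝ] ℝ, ∀ α ∈ Δ, f α = 1 := by
  let b : Module.Basis {x : E // x ∈ Δ} ℝ E := Module.Basis.mk hΔ.2.1 (by
    rw [Subtype.range_coe_subtype]
    exact hΔ.2.2.1.ge)
  refine ⟨b.constr ℝ fun _ => 1, fun α hα => ?_⟩
  have h := b.constr_basis ℝ (fun _ => (1 : ℝ)) ⟨α, hα⟩
  rwa [Module.Basis.mk_apply] at h

/-- An automorphism of the root system permuting the extended base `Δ ∪ {-htilde}` preserves
heights modulo `f htilde + 1`. -/
lemma IsBaseRS.exists_height_map_sub {Φ : Set E} {Δ : Finset E} (hΔ : IsBaseRS Φ Δ)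
    {f : E →ₗ[ℝ] ℝ} (hf : ∀ α ∈ Δ, f α = 1) {htilde : E} {ω : E ≃ₗᵢ[ℝ] E}
    (hω : ∀ α ∈ Δ, ω α ∈ Δ ∨ ω α = -htilde) {β : E} (hβ : β ∈ Φ) :
    ∃ k : ℤ, f (ω β) - f β = k * (f htilde + 1) := by
  obtain ⟨c, -, hc⟩ := hΔ.2.2.2 β hβ
  have h : ∀ α ∈ Δ, ∃ k : ℤ, f (ω α) - f α = k * (f htilde + 1) := fun α hα => by
    rcases hω α hα with h | h
    · exact ⟨0, by simp [hf _ h, hf _ hα]⟩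
    · exact ⟨-1, by rw [h, map_neg, hf _ hα]; push_cast; ring⟩
  choose! k hk using h
  refine ⟨∑ α ∈ Δ, c α * k α, ?_⟩
  rw [hc]
  simp only [map_sum, map_smul, smul_eq_mul]
  rw [← Finset.sum_sub_distrib]
  push_cast
  rw [Finset.sum_mul]
  refine Finset.sum_congr rfl fun α hα => ?_
  rw [← mul_sub, hk α hα, mul_assoc]

lemma IsBaseRS.exists_height_pow_sub {Φ : Set E} {Δ : Finset E} (hΔ : IsBaseRS Φ Δ)
    {f : E →ₗ[ℝ] ℝ} (hf : ∀ α ∈ Δ, f α = 1) {htilde : E} {ω : E ≃ₗᵢ[ℝ] E}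
    (hω : ∀ α ∈ Δ, ω α ∈ Δ ∨ ω α = -htilde) (hωΦ : ∀ β ∈ Φ, ω β ∈ Φ) {β : E} (hβ : β ∈ Φ)
    (n : ℕ) : ∃ k : ℤ, f ((ω ^ n) β) - f β = k * (f htilde + 1) := by
  induction n with
  | zero => exact ⟨0, by simp⟩
  | succ n ih =>
    obtain ⟨k, hk⟩ := ih
    obtain ⟨l, hl⟩ := hΔ.exists_height_map_sub hf hω (pow_apply_mem hωΦ hβ n)
    refine ⟨l + k, ?_⟩
    have : (ω ^ (n + 1)) β = ω ((ω ^ n) β) := by rw [pow_succ']; rfl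
    rw [this]
    push_cast
    linarith

lemma IsBaseRS.height_ne_zero {Φ : Set E} {Δ : Finset E} (hΔ : IsBaseRS Φ Δ)
    {f : E →ₗ[ℝ] ℝ} (hf : ∀ α ∈ Δ, f α = 1) {β : E} (hβ : β ∈ Φ) (hβ0 : β ≠ 0) :
    f β ≠ 0 := by
  obtain ⟨c, hsign, hc⟩ := hΔ.2.2.2 β hβ
  have hval : f β = ∑ α ∈ Δ, (c α : ℝ) := by
    conv_lhs => rw [hc]
    simp only [map_sum, map_smul, smul_eq_mul]
    exact Finset.sum_congr rfl fun α hα => by rw [hf α hα, mul_one]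
  intro h0
  rw [hval] at h0
  refine hβ0 (hc.trans (Finset.sum_eq_zero fun α hα => ?_))
  have : ∀ α ∈ Δ, (c α : ℝ) = 0 := by
    rcases hsign with h | h
    · exact (Finset.sum_eq_zero_iff_of_nonneg fun α _ => by exact_mod_cast h α).1 h0
    · exact (Finset.sum_eq_zero_iff_of_nonpos fun α _ => by exact_mod_cast h α).1 h0
  rw [this α hα, zero_smul]

lemma avg_map (ω : E ≃ₗᵢ[ℝ] E) (x : E) : avg ω (ω x) = avg ω x := by
  have h : ∀ t : ℕ, (ω ^ (t + 1)) (ω x) = (ω ^ (t + 1 + 1)) x := fun t => by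
    rw [pow_succ ω (t + 1)]; rfl
  simp only [avg, h]
  congr 1
  have h1 := Finset.sum_range_succ (fun t => (ω ^ (t + 1)) x) (orderOf ω)
  rw [Finset.sum_range_succ'] at h1
  have h2 : (ω ^ (orderOf ω + 1)) x = (ω ^ (0 + 1)) x := by rw [pow_succ, pow_orderOf_eq_one]; simp
  rw [h2] at h1
  exact add_right_cancel h1

lemma avg_pow_apply (ω : E ≃ₗᵢ[ℝ] E) (x : E) (n : ℕ) : avg ω ((ω ^ n) x) = avg ω x := by
  induction n with
  | zero => simp
  | succ n ih => rw [← ih, ← avg_map ω ((ω ^ n) x), pow_succ']; rfl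

lemma avg_neg (ω : E ≃ₗᵢ[ℝ] E) (x : E) : avg ω (-x) = -avg ω x := by
  simp [avg]

lemma avg_sum {ι : Type*} (ω : E ≃ₗᵢ[ℝ] E) (s : Finset ι) (g : ι → E) :
    avg ω (∑ i ∈ s, g i) = ∑ i ∈ s, avg ω (g i) := by
  simp only [avg, map_sum]
  rw [Finset.sum_comm, Finset.smul_sum]

lemma avg_of_fixed {ω : E ≃ₗᵢ[ℝ] E} (hω : orderOf ω ≠ 0) {x : E} (hx : ω x = x) :
    avg ω x = x := by
  have h : ∀ n : ℕ, (ω ^ n) x = x := fun n => by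
    induction n with
    | zero => simp
    | succ n ih => rw [pow_succ']; exact (congrArg ω ih).trans hx
  simp only [avg, h, Finset.sum_const, Finset.card_range]
  rw [← Nat.cast_smul_eq_nsmul ℝ, smul_smul, inv_mul_cancel₀ (by exact_mod_cast hω), one_smul]

lemma orderOf_ne_zero_of_avg_ne_zero {ω : E ≃ₗᵢ[ℝ] E} {x : E} (h : avg ω x ≠ 0) :
    orderOf ω ≠ 0 := fun h0 => h (by simp [avg, h0])

lemma exists_pow_of_mem_orbitOf {ω : E ≃ₗᵢ[ℝ] E} (hω : orderOf ω ≠ 0) {β γ : E}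
    (hγ : γ ∈ orbitOf ω β) : ∃ n < orderOf ω, (ω ^ n) β = γ := by
  obtain ⟨t, rfl⟩ := hγ
  have hpos : (0 : ℤ) < orderOf ω := by exact_mod_cast Nat.pos_of_ne_zero hω
  obtain ⟨n, hn⟩ := Int.eq_ofNat_of_zero_le (Int.emod_nonneg t hpos.ne')
  have hlt := Int.emod_lt_of_pos t hpos
  refine ⟨n, by omega, ?_⟩
  rw [← zpow_mod_orderOf ω t, hn, zpow_natCast]

lemma orbitOf_finite {ω : E ≃ₗᵢ[ℝ] E} (hω : orderOf ω ≠ 0) (β : E) : (orbitOf ω β).Finite :=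
  ((Set.finite_lt_nat (orderOf ω)).image fun n => (ω ^ n) β).subset fun _ hγ =>
    exists_pow_of_mem_orbitOf hω hγ

lemma self_mem_orbitOf (ω : E ≃ₗᵢ[ℝ] E) (β : E) : β ∈ orbitOf ω β := ⟨0, by simp⟩

lemma map_mem_orbitOf {ω : E ≃ₗᵢ[ℝ] E} {β γ : E} (hγ : γ ∈ orbitOf ω β) :
    ω γ ∈ orbitOf ω β := by
  obtain ⟨t, rfl⟩ := hγ
  exact ⟨1 + t, by rw [zpow_one_add]; rfl⟩

/-- The sum over an orbit is the average times the size of the orbit. -/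
lemma sum_orbit_eq {ω : E ≃ₗᵢ[ℝ] E} (hω : orderOf ω ≠ 0) {β : E} {F : Finset E}
    (hF : (F : Set E) = orbitOf ω β) : ∑ γ ∈ F, γ = (F.card : ℝ) • avg ω β := by
  classical
  have hmem : ∀ γ, γ ∈ F ↔ γ ∈ orbitOf ω β := fun γ => by rw [← hF, Finset.mem_coe]
  have himg : F.image ω = F := Finset.eq_of_subset_of_card_le
    (fun γ hγ => by
      obtain ⟨δ, hδ, rfl⟩ := Finset.mem_image.1 hγ
      exact (hmem _).2 (map_mem_orbitOf ((hmem _).1 hδ)))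
    (Finset.card_image_of_injective F ω.injective).ge
  have hfix : ω (∑ γ ∈ F, γ) = ∑ γ ∈ F, γ := by
    conv_rhs => rw [← himg]
    rw [map_sum, Finset.sum_image ω.injective.injOn]
  rw [← avg_of_fixed hω hfix, avg_sum, Finset.sum_congr rfl fun γ hγ => ?_, Finset.sum_const,
    Nat.cast_smul_eq_nsmul]
  obtain ⟨n, -, rfl⟩ := exists_pow_of_mem_orbitOf hω ((hmem γ).1 hγ)
  exact avg_pow_apply ω β n

lemma inner_avg_pow_apply (ω : E ≃ₗᵢ[ℝ] E) (β x : E) (n : ℕ) :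
    ⟪avg ω β, (ω ^ n) x⟫ = ⟪avg ω β, x⟫ := by
  have hfix : ω (avg ω β) = avg ω β := by
    conv_rhs => rw [← avg_map]
    simp only [avg, map_smul, map_sum]
    refine congrArg _ (Finset.sum_congr rfl fun t _ => ?_)
    exact (congrArg (fun g : E ≃ₗᵢ[ℝ] E => g β) (pow_succ' ω (t + 1))).symm.trans
      (congrArg (fun g : E ≃ₗᵢ[ℝ] E => g β) (pow_succ ω (t + 1)))
  induction n with
  | zero => simp
  | succ n ih =>
    rw [← ih, ← ω.inner_map_map (avg ω β) ((ω ^ n) x), hfix, pow_succ']; rfl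

/-- The coroot formula for an orbit whose elements are pairwise equal, opposite, orthogonal or
at angle `2π/3`. -/
lemma coroot_avg_eq {ω : E ≃ₗᵢ[ℝ] E} {β : E} (havg : avg ω β ≠ 0)
    (hnbr : ∀ γ ∈ nbrOf ω β, ⟪β, γ⟫ = -(⟪β, β⟫ / 2)) :
    coroot (avg ω β) =
      (2 / (2 - ((nbrOf ω β).ncard : ℝ))) • ∑ᶠ γ ∈ orbitOf ω β, coroot γ := by
  classical
  have hω := orderOf_ne_zero_of_avg_ne_zero havg
  have hfin := orbitOf_finite hω β
  set F := hfin.toFinset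
  have hF : (F : Set E) = orbitOf ω β := hfin.coe_toFinset
  have hmem : ∀ γ, γ ∈ F ↔ γ ∈ orbitOf ω β := fun γ => hfin.mem_toFinset
  have hβF : β ∈ F := (hmem β).2 (self_mem_orbitOf ω β)
  have hS := sum_orbit_eq hω hF
  have hneg : -β ∉ orbitOf ω β := fun h => by
    obtain ⟨n, -, hn⟩ := exists_pow_of_mem_orbitOf hω h
    have h1 := avg_pow_apply ω β n
    rw [hn, avg_neg] at h1
    have h2 : (2 : ℝ) • avg ω β = 0 := by
      rw [two_smul]
      nth_rewrite 1 [← h1]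
      exact neg_add_cancel _
    exact havg ((smul_eq_zero.1 h2).resolve_left two_ne_zero)
  have hpow : ∀ γ ∈ F, ∃ n : ℕ, (ω ^ n) β = γ := fun γ hγ => by
    obtain ⟨n, -, hn⟩ := exists_pow_of_mem_orbitOf hω ((hmem γ).1 hγ)
    exact ⟨n, hn⟩
  have hβ0 : β ≠ 0 := by
    rintro rfl
    exact havg (by simp [avg])
  have hL : 0 < ⟪β, β⟫ := real_inner_self_pos.2 hβ0
  have hv : 0 < ⟪avg ω β, avg ω β⟫ := real_inner_self_pos.2 havg
  have hm : (0 : ℝ) < F.card := by exact_mod_cast Finset.card_pos.2 ⟨β, hβF⟩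
  have hcor : ∑ᶠ γ ∈ orbitOf ω β, coroot γ = (2 / ⟪β, β⟫ * F.card) • avg ω β := by
    rw [← hF, finsum_mem_coe_finset, mul_smul, ← hS, Finset.smul_sum]
    refine Finset.sum_congr rfl fun γ hγ => ?_
    obtain ⟨n, rfl⟩ := hpow γ hγ
    rw [coroot, LinearIsometryEquiv.inner_map_map]
  have hvv : ⟪avg ω β, avg ω β⟫ = ⟪avg ω β, β⟫ := by
    have h : (F.card : ℝ) * ⟪avg ω β, avg ω β⟫ = F.card * ⟪avg ω β, β⟫ := by
      rw [← real_inner_smul_right, ← hS, inner_sum, Finset.sum_congr rfl fun γ hγ => ?_,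
        Finset.sum_const, nsmul_eq_mul]
      obtain ⟨n, rfl⟩ := hpow γ hγ
      exact inner_avg_pow_apply ω β β n
    exact mul_left_cancel₀ hm.ne' h
  have hN : nbrOf ω β = ((F.erase β).filter fun γ => ⟪β, γ⟫ ≠ 0 : Finset E) := by
    ext γ
    simp only [nbrOf, Set.mem_ofPred_eq, Finset.coe_filter, Finset.mem_erase, hmem]
    refine ⟨fun h => ⟨⟨h.2.1, h.1⟩, h.2.2.2⟩, fun h => ⟨h.1.2, h.1.1, ?_, h.2⟩⟩
    rintro rfl
    exact hneg h.1.2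
  have hsum : (F.card : ℝ) * ⟪avg ω β, avg ω β⟫ =
      ⟪β, β⟫ - (nbrOf ω β).ncard * (⟪β, β⟫ / 2) := by
    rw [hvv, ← real_inner_smul_left, ← hS, real_inner_comm, inner_sum,
      ← Finset.add_sum_erase F _ hβF, ← Finset.sum_filter_ne_zero,
      Finset.sum_congr rfl fun γ hγ => hnbr γ (hN ▸ Finset.mem_coe.2 hγ), Finset.sum_const,
      nsmul_eq_mul, hN, Set.ncard_coe_finset]
    ring
  rw [hcor, coroot, smul_smul]
  congr 1
  have hn : (2 - ((nbrOf ω β).ncard : ℝ)) ≠ 0 := fun h => by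
    have : (F.card : ℝ) * ⟪avg ω β, avg ω β⟫ = 0 := by
      rw [hsum]; linear_combination (⟪β, β⟫ / 2) * h
    exact (mul_pos hm hv).ne' this
  field_simp
  linear_combination -2 * hsum

end Folding

theorem coroot_of_average
    {E : Type*} [NormedAddCommGroup E] [InnerProductSpace ℝ E] [FiniteDimensional ℝ E]
    (Φ : Set E) (Δ : Finset E) (coeff : E → E → ℝ) (htilde : E) (ω : E ≃ₗᵢ[ℝ] E)
    (hΦrs : IsRootSystem Φ) (hΦred : IsReducedRS Φ) (hΦirr : IsIrreducibleRS Φ)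
    (hΔ : IsBaseRS Φ Δ)
    (hcoeff : ∀ β ∈ Φ, β = ∑ α ∈ Δ, coeff β α • α)
    (hht : htilde ∈ Φ)
    (hhighest : ∀ β ∈ Φ, β ≠ htilde → ∑ α ∈ Δ, coeff β α < ∑ α ∈ Δ, coeff htilde α)
    (hωW : InWeylGroup Φ ω)
    (hωΔ₀ : ⇑ω '' (↑Δ ∪ {-htilde}) = ↑Δ ∪ {-htilde}) :
    ∀ β ∈ Φ, avg ω β ≠ 0 →
      coroot (avg ω β) =
        (2 / (2 - ((nbrOf ω β).ncard : ℝ))) • ∑ᶠ γ ∈ orbitOf ω β, coroot γ := by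
  obtain ⟨f, hf⟩ := hΔ.exists_height
  have hωΦ : ∀ β ∈ Φ, ω β ∈ Φ := fun β hβ => hωW.map_mem hΦrs hβ
  have hωΔ : ∀ α ∈ Δ, ω α ∈ Δ ∨ ω α = -htilde := fun α hα => by
    have h : ω α ∈ (↑Δ ∪ {-htilde} : Set E) := hωΔ₀ ▸ Set.mem_image_of_mem ω (Or.inl hα)
    simpa [or_comm] using h
  have hsum : ∀ β ∈ Φ, f β = ∑ α ∈ Δ, coeff β α := fun β hβ => by
    conv_lhs => rw [hcoeff β hβ]
    simp only [map_sum, map_smul, smul_eq_mul]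
    exact Finset.sum_congr rfl fun α hα => by rw [hf α hα, mul_one]
  have hle : ∀ β ∈ Φ, f β ≤ f htilde := fun β hβ => by
    rcases eq_or_ne β htilde with rfl | hne
    · exact le_rfl
    · rw [hsum β hβ, hsum _ hht]
      exact (hhighest β hβ hne).le
  intro β hβ havg
  have hω := orderOf_ne_zero_of_avg_ne_zero havg
  refine coroot_avg_eq havg ?_
  rintro γ ⟨hγ, hne, hne', h0⟩
  obtain ⟨n, -, rfl⟩ := exists_pow_of_mem_orbitOf hω hγ
  refine hΦrs.inner_eq_of_sub_notMem hβ (pow_apply_mem hωΦ hβ n)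
    (LinearIsometryEquiv.inner_map_map _ _ _) hne hne' h0 fun hδ => ?_
  obtain ⟨k, hk⟩ := hΔ.exists_height_pow_sub hf hωΔ hωΦ hβ n
  rw [← map_sub] at hk
  have hk0 : k ≠ 0 := by
    rintro rfl
    exact hΔ.height_ne_zero hf hδ (hΦrs.ne_zero hδ) (by simpa using hk)
  have h1 := hle _ hδ
  have h2 := hle _ (hΦrs.neg_mem hδ)
  rw [map_neg, hk] at h2
  rw [hk] at h1
  have h3 : 0 ≤ f htilde := by
    have h4 := hle _ (hΦrs.neg_mem hht)
    rw [map_neg] at h4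
    linarith
  rcases lt_or_gt_of_ne hk0 with hlt | hgt
  · have : (k : ℝ) ≤ -1 := by exact_mod_cast Int.le_sub_one_of_lt hlt
    nlinarith
  · have : (1 : ℝ) ≤ k := by exact_mod_cast hgt
    nlinarith
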